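/- For all u, v, w ∈ ℝ³ with self-dual matrices U, V, W, the symmetric part of the triple matrix product is proportional to the identity: ½(UVW + (UVW)ᵀ) = ⅛ ((u × v)·w) · 1, where 1 is the 4×4 identity matrix. -/

import Mathlib

noncomputable section
open Matrix BigOperators

/-- The so(4) generator `T_{ab}` with entries `(T_{ab})^I_J = δ_a^I δ_{bJ} − δ_{aJ} δ_b^I`. -/
def Tgen (a b : Fin 4) : Matrix (Fin 4) (Fin 4) ℝ :=
  Matrix.of fun I J =>
    (if I = a then (1:ℝ) else 0) * (if J = b then (1:ℝ) else 0)
      - (if J = a then (1:ℝ) else 0) * (if I = b then (1:ℝ) else 0)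

/-- The three-dimensional Levi-Civita symbol. -/
def eps3 (a b c : Fin 3) : ℝ :=
  ((((b:ℤ) - (a:ℤ)) * ((c:ℤ) - (a:ℤ)) * ((c:ℤ) - (b:ℤ)) : ℤ) : ℝ) / 2

/-- The self-dual generators `T_{+a} = ½(T_{0a} + ½ Σ ε_{abc} T_{bc})`, `a = 1,2,3`. -/
def Tplus (a : Fin 3) : Matrix (Fin 4) (Fin 4) ℝ :=
  (1/2 : ℝ) • (Tgen 0 a.succ
    + (1/2 : ℝ) • ∑ b : Fin 3, ∑ c : Fin 3, eps3 a b c • Tgen b.succ c.succ)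

/-- The self-dual matrix `Σ_a u^a T_{+a}` of a vector `u ∈ ℝ³`. -/
def sd (u : Fin 3 → ℝ) : Matrix (Fin 4) (Fin 4) ℝ := ∑ a : Fin 3, u a • Tplus a

/-- The cross product on ℝ³. -/
def cross (u v : Fin 3 → ℝ) : Fin 3 → ℝ :=
  ![u 1 * v 2 - u 2 * v 1, u 2 * v 0 - u 0 * v 2, u 0 * v 1 - u 1 * v 0]


set_option maxHeartbeats 2000000 in
/-- The explicit entries of a self-dual matrix. -/
theorem sd_eq (u : Fin 3 → ℝ) :
    sd u = (1/2 : ℝ) • !![0, u 0, u 1, u 2; -u 0, 0, u 2, -u 1;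
      -u 1, -u 2, 0, u 0; -u 2, u 1, -u 0, 0] := by
  ext i j
  fin_cases i <;> fin_cases j <;>
    simp [sd, Tplus, Tgen, eps3, Fin.sum_univ_three] <;> ring

set_option maxHeartbeats 2000000 in
/-- the symmetric part of the triple product of self-dual matrices is
proportional to the identity: `½(UVW + (UVW)ᵀ) = ⅛((u × v)·w)·1`. -/
theorem selfdual_triple_product_symmetric_part (u v w : Fin 3 → ℝ) :
    (1/2 : ℝ) • (sd u * sd v * sd w + (sd u * sd v * sd w)ᵀ)
      = ((1/8 : ℝ) * ∑ a : Fin 3, cross u v a * w a) • (1 : Matrix (Fin 4) (Fin 4) ℝ) := by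
  rw [sd_eq, sd_eq, sd_eq]
  ext i j
  fin_cases i <;> fin_cases j <;>
    simp [Fin.sum_univ_three, cross] <;> ring

end
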